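/- arXiv:2601.14585 — 2 statements merged into one kernel-verified Lean document; each statement's English description precedes it below -/
import Mathlib

section
/- Let k be a positive integer and let S(V,E) be a k-star inscribed in a circle. Then the sum over all v ∈ V of the interior angles ∠v⁻vv⁺ equals π. -/
open Complex
open scoped Classical

noncomputable section

/-- The anticlockwise arc displacement from `u` to `v` on the unit circle, lying in `(0, 2π]`
(equal to `2π` when `v = u`). -/
def posArc (u v : ℂ) : ℝ :=
  if 0 < Complex.arg (v / u) then Complex.arg (v / u) else Complex.arg (v / u) + 2 * Real.pi

/-- `u, v, w` occur in anticlockwise order on the circle. -/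
def ACW (u v w : ℂ) : Prop :=
  u ≠ v ∧ v ≠ w ∧ u ≠ w ∧ posArc u v < posArc u w

/-- The open anticlockwise arc from `u` to `v`. -/
def arcOO (u v : ℂ) : Set ℂ := {x | x ≠ u ∧ x ≠ v ∧ posArc u x < posArc u v}

/-- The anticlockwise arc from `u` to `v`, open at `u` and closed at `v`. -/
def arcOC (u v : ℂ) : Set ℂ := {x | x ≠ u ∧ (x = v ∨ posArc u x < posArc u v)}

/-- The closed anticlockwise arc from `u` to `v`. -/
def arcCC (u v : ℂ) : Set ℂ := {x | x = u ∨ x = v ∨ (x ≠ u ∧ posArc u x < posArc u v)}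

/-- The (undirected) angle `∠ x v z` at apex `v`. -/
def vangle (x v z : ℂ) : ℝ := |Complex.arg ((x - v) / (z - v))|

/-- A cyclic polygon: a finite set of vertices on the unit circle together with a set of
directed edges such that every vertex has indegree and outdegree one, and any two
consecutive edges `uv`, `vw` have `u, v, w` in anticlockwise order. -/
structure CyclicPolygon where
  V : Finset ℂ
  E : Finset (ℂ × ℂ)
  nonempty : V.Nonempty
  onCircle : ∀ v ∈ V, ‖v‖ = 1
  endmem : ∀ e ∈ E, e.1 ∈ V ∧ e.2 ∈ V
  outdeg : ∀ v ∈ V, ∃! w, (v, w) ∈ E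
  indeg : ∀ v ∈ V, ∃! u, (u, v) ∈ E
  acw : ∀ u v w : ℂ, (u, v) ∈ E → (v, w) ∈ E → ACW u v w

namespace CyclicPolygon

/-- The successor `v⁺` of a vertex. -/
noncomputable def next (P : CyclicPolygon) (v : ℂ) : ℂ :=
  if h : ∃ w, (v, w) ∈ P.E then h.choose else v

/-- The predecessor `v⁻` of a vertex. -/
noncomputable def prev (P : CyclicPolygon) (v : ℂ) : ℂ :=
  if h : ∃ u, (u, v) ∈ P.E then h.choose else v

end CyclicPolygon

/-- The interior angle `∠ v⁻ v v⁺` of `P` at `v`. -/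
def interiorAngle (P : CyclicPolygon) (v : ℂ) : ℝ :=
  vangle (P.prev v) v (P.next v)

/-- The length of an edge `uv`: the number of vertices on the open anticlockwise
arc from `u` to `v`, plus one. -/
def edgeLength (P : CyclicPolygon) (u v : ℂ) : ℕ :=
  ((P.V : Set ℂ) ∩ arcOO u v).ncard + 1

/-- A `k`-star: a cyclic polygon with `2k+1` vertices all of whose edges have length `k`. -/
def IsKStar (S : CyclicPolygon) (k : ℕ) : Prop :=
  S.V.card = 2 * k + 1 ∧ ∀ e ∈ S.E, edgeLength S e.1 e.2 = k

/-- A star: a `k`-star for some positive integer `k`. -/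
def IsStar (S : CyclicPolygon) : Prop := ∃ k : ℕ, 0 < k ∧ IsKStar S k

/-- The segment from `u` to `x` splits the interior angle `∠ u⁻ u u⁺` of `S` at `u`
into the two (smaller, nonzero) angles `∠ u⁻ u x` and `∠ x u u⁺`. -/
def SplitsVertexAngle (S : CyclicPolygon) (u x : ℂ) : Prop :=
  u ∈ S.V ∧ 0 < vangle (S.prev u) u x ∧ 0 < vangle x u (S.next u) ∧
    vangle (S.prev u) u x + vangle x u (S.next u) = vangle (S.prev u) u (S.next u)

/-- `(u, v)` is a linkable pair for the pair of cyclic polygons `(S₁, S₂)`: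
the segment `uv` splits the angle of `S₁` at `u` and the angle of `S₂` at `v`. -/
def LinkablePair (S₁ S₂ : CyclicPolygon) (u v : ℂ) : Prop :=
  u ≠ v ∧ SplitsVertexAngle S₁ u v ∧ SplitsVertexAngle S₂ v u

/-- `u, v` is a linkable pair of vertices of the cyclic polygon `P`. -/
def Linkable (P : CyclicPolygon) (u v : ℂ) : Prop := LinkablePair P P u v

/-- `D` is a set of (undirected) diagonals of `P`, i.e. every member joins a linkable pair. -/
def IsDiagonalSet (P : CyclicPolygon) (D : Set (Sym2 ℂ)) : Prop :=
  ∀ u v : ℂ, s(u, v) ∈ D → Linkable P u v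

/-- The set `D̃` of directed edges associated to a set of diagonals `D`. -/
def tilde (D : Set (Sym2 ℂ)) : Set (ℂ × ℂ) := {e | s(e.1, e.2) ∈ D}

/-- The segment from `v` towards `x` splits the angle `∠ u v w`. -/
def SplitsAngle3 (u v w x : ℂ) : Prop :=
  0 < vangle u v x ∧ 0 < vangle x v w ∧ vangle u v x + vangle x v w = vangle u v w

/-- `𝒮` is a star decomposition of `P` with respect to the diagonal set `D`: the
cycle decomposition of `E ∪ D̃` determined by `f_next` (each cycle follows the
tightest turn, i.e. no diagonal of `D` splits the angle between two consecutive
edges of a cycle), all of whose cycles are stars. -/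
def IsStarDecomp (P : CyclicPolygon) (D : Set (Sym2 ℂ)) (𝒮 : Finset CyclicPolygon) : Prop :=
  IsDiagonalSet P D ∧
  (∀ S ∈ 𝒮, IsStar S ∧ (S.V : Set ℂ) ⊆ (P.V : Set ℂ)) ∧
  (∀ S ∈ 𝒮, (S.E : Set (ℂ × ℂ)) ⊆ (P.E : Set (ℂ × ℂ)) ∪ tilde D) ∧
  (∀ e ∈ (P.E : Set (ℂ × ℂ)) ∪ tilde D, ∃ S ∈ 𝒮, e ∈ S.E) ∧
  (∀ S₁ ∈ 𝒮, ∀ S₂ ∈ 𝒮, S₁ ≠ S₂ → ∀ e : ℂ × ℂ, e ∈ S₁.E → e ∉ S₂.E) ∧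
  (∀ S ∈ 𝒮, ∀ u v w : ℂ, (u, v) ∈ S.E → (v, w) ∈ S.E →
      ¬ ∃ x, s(v, x) ∈ D ∧ SplitsAngle3 u v w x)

/-- `P` admits a star decomposition with respect to `D`. -/
def HasStarDecomp (P : CyclicPolygon) (D : Set (Sym2 ℂ)) : Prop :=
  ∃ 𝒮 : Finset CyclicPolygon, IsStarDecomp P D 𝒮

/-- A maximal star decomposition: no proper superset of `D` admits a star decomposition. -/
def IsMaximalStarDecomp (P : CyclicPolygon) (D : Set (Sym2 ℂ))
    (𝒮 : Finset CyclicPolygon) : Prop :=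
  IsStarDecomp P D 𝒮 ∧ ∀ D' : Set (Sym2 ℂ), D ⊂ D' → ¬ HasStarDecomp P D'

/-- `D'` is obtained from `D` by a diagonal flip: remove one diagonal and add another. -/
def FlipStep (D D' : Set (Sym2 ℂ)) : Prop :=
  ∃ e f : Sym2 ℂ, e ∈ D ∧ f ∉ D ∧ D' = (D \ {e}) ∪ {f}

/-- The two chords `ab` and `cd` are crossing: they share no endpoint and
intersect inside the circle. -/
def Crossing (a b c d : ℂ) : Prop :=
  a ≠ c ∧ a ≠ d ∧ b ≠ c ∧ b ≠ d ∧ (openSegment ℝ a b ∩ openSegment ℝ c d).Nonempty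

/-- The two chords `ab` and `cd` share a common point: they have a common
endvertex or intersect inside the circle. -/
def ShareCommonPoint (a b c d : ℂ) : Prop :=
  a = c ∨ a = d ∨ b = c ∨ b = d ∨ (openSegment ℝ a b ∩ openSegment ℝ c d).Nonempty

/-- Two cyclic polygons have a pair of overlapped angles: a common vertex `y` and a vertex
`x` of either polygon lying on both arcs `⦅y⁺ y⁻⟧` (taken in each polygon). -/
def OverlappedAngles (S₁ S₂ : CyclicPolygon) : Prop :=
  ∃ y : ℂ, y ∈ S₁.V ∧ y ∈ S₂.V ∧
    ∃ x : ℂ, (x ∈ S₁.V ∨ x ∈ S₂.V) ∧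
      x ∈ arcOC (S₁.next y) (S₁.prev y) ∧ x ∈ arcOC (S₂.next y) (S₂.prev y)

/-- Two cyclic polygons are mutually independent: no two of their angles are overlapped. -/
def IndepPolygons (S₁ S₂ : CyclicPolygon) : Prop := ¬ OverlappedAngles S₁ S₂

/-- The edge `uv` of `P` is minimal: no edge `xy` of `P` has all vertices of the closed
arc from `x` to `y` inside the open arc from `u` to `v`. -/
def MinimalEdge (P : CyclicPolygon) (u v : ℂ) : Prop :=
  (u, v) ∈ P.E ∧
    ¬ ∃ x y : ℂ, (x, y) ∈ P.E ∧ ∀ z ∈ P.V, z ∈ arcCC x y → z ∈ arcOO u v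

/-- `vs` enumerates the star `S` as `v₀ v₁ ⋯ v₂ₖ` with `v₁ = v`, `v₀ = v⁻` (so that `v⁻v`
is an edge of `S`), each edge of `S` is an edge of `P` or a diagonal of `P`, and all the
edges `v₂ᵢ₋₁v₂ᵢ` are edges of `P`. -/
def IsBorderCandidate (P : CyclicPolygon) (v : ℂ) (S : CyclicPolygon) (k : ℕ)
    (vs : ℕ → ℂ) : Prop :=
  0 < k ∧ IsStar S ∧ S.V.card = 2 * k + 1 ∧
  (S.V : Set ℂ) ⊆ (P.V : Set ℂ) ∧
  vs 0 = P.prev v ∧ vs 1 = v ∧ vs (2 * k + 1) = vs 0 ∧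
  (∀ x ∈ S.V, ∃ i ≤ 2 * k, vs i = x) ∧
  (∀ i ≤ 2 * k, (vs i, vs (i + 1)) ∈ S.E) ∧
  (∀ i ≤ 2 * k, (vs i, vs (i + 1)) ∈ P.E ∨ Linkable P (vs i) (vs (i + 1))) ∧
  (∀ i : ℕ, 1 ≤ i → i ≤ k → (vs (2 * i - 1), vs (2 * i)) ∈ P.E)

/-- The angle sequence `(∠v₁v₂v₃, ∠v₃v₄v₅, …, ∠v₂ₖ₋₁v₂ₖv₀)` of an enumerated star. -/
noncomputable def angleList (vs : ℕ → ℂ) (k : ℕ) : List ℝ :=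
  (List.range k).map fun i => vangle (vs (2 * i + 1)) (vs (2 * i + 2)) (vs (2 * i + 3))

/-- `S` is the border star `S*(P, v)`: among all border candidates, its angle sequence is
lexicographically minimal. -/
def IsBorderStar (P : CyclicPolygon) (v : ℂ) (S : CyclicPolygon) : Prop :=
  ∃ (k : ℕ) (vs : ℕ → ℂ), IsBorderCandidate P v S k vs ∧
    ∀ (S' : CyclicPolygon) (k' : ℕ) (vs' : ℕ → ℂ), IsBorderCandidate P v S' k' vs' →
      ¬ List.Lex (· < ·) (angleList vs' k') (angleList vs k)


lemma next_mem (P : CyclicPolygon) {v : ℂ} (hv : v ∈ P.V) : (v, P.next v) ∈ P.E := by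
  have h : ∃ w, (v, w) ∈ P.E := (P.outdeg v hv).exists
  unfold CyclicPolygon.next
  rw [dif_pos h]
  exact h.choose_spec

lemma prev_mem (P : CyclicPolygon) {v : ℂ} (hv : v ∈ P.V) : (P.prev v, v) ∈ P.E := by
  have h : ∃ w, (w, v) ∈ P.E := (P.indeg v hv).exists
  unfold CyclicPolygon.prev
  rw [dif_pos h]
  exact h.choose_spec

lemma sum_next (P : CyclicPolygon) (f : ℂ → ℂ → ℝ) :
    ∑ v ∈ P.V, f (P.prev v) v = ∑ v ∈ P.V, f v (P.next v) := by
  have hp : ∀ v ∈ P.V, P.prev v ∈ P.V := fun v hv => (P.endmem _ (prev_mem P hv)).1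
  have hn : ∀ v ∈ P.V, P.next v ∈ P.V := fun v hv => (P.endmem _ (next_mem P hv)).2
  have hnp : ∀ v ∈ P.V, P.next (P.prev v) = v := fun v hv =>
    (P.outdeg _ (hp v hv)).unique (next_mem P (hp v hv)) (prev_mem P hv)
  have hpn : ∀ v ∈ P.V, P.prev (P.next v) = v := fun v hv =>
    (P.indeg _ (hn v hv)).unique (prev_mem P (hn v hv)) (next_mem P hv)
  refine Finset.sum_bij' (fun v _ => P.prev v) (fun v _ => P.next v) hp hn hnp hpn ?_
  intro v hv
  simp only [hnp v hv]

lemma posArc_bounds (u v : ℂ) : 0 < posArc u v ∧ posArc u v ≤ 2 * Real.pi := by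
  have h1 := Complex.arg_le_pi (v / u)
  have h2 := Complex.neg_pi_lt_arg (v / u)
  have := Real.pi_pos
  unfold posArc
  split_ifs <;> constructor <;> linarith

lemma posArc_arg {u v : ℂ} (hu : ‖u‖ = 1) (hv : ‖v‖ = 1) :
    posArc u v = arg v - arg u + (if arg v ≤ arg u then 2 * Real.pi else 0) := by
  have hu0 : u ≠ 0 := by rintro rfl; simp at hu
  have hv0 : v ≠ 0 := by rintro rfl; simp at hv
  have key : ∃ m : ℤ, posArc u v = arg v - arg u + 2 * Real.pi * m := by
    have := Complex.arg_div_coe_angle hv0 hu0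
    rw [← Real.Angle.coe_sub, Real.Angle.angle_eq_iff_two_pi_dvd_sub] at this
    obtain ⟨n, hn⟩ := this
    unfold posArc
    split_ifs
    · exact ⟨n, by linarith⟩
    · exact ⟨n + 1, by push_cast; linarith⟩
  obtain ⟨m, hm⟩ := key
  obtain ⟨b1, b2⟩ := posArc_bounds u v
  have := Real.pi_pos
  have h1 := Complex.arg_le_pi u
  have h2 := Complex.neg_pi_lt_arg u
  have h3 := Complex.arg_le_pi v
  have h4 := Complex.neg_pi_lt_arg v
  rw [hm] at b1 b2 ⊢
  split_ifs with h
  · have m1 : (0 : ℝ) < m := by by_contra! hc; nlinarith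
    have m2 : (m : ℝ) < 2 := by by_contra! hc; nlinarith
    have : m = 1 := by
      have : (0 : ℤ) < m := by exact_mod_cast m1
      have : m < 2 := by exact_mod_cast m2
      omega
    subst this; simp
  · push Not at h
    have m1 : (-1 : ℝ) < m := by by_contra! hc; nlinarith
    have m2 : (m : ℝ) < 1 := by by_contra! hc; nlinarith
    have : m = 0 := by
      have : (-1 : ℤ) < m := by exact_mod_cast m1
      have : m < 1 := by exact_mod_cast m2
      omega
    subst this; simp

lemma exp_posArc {u v : ℂ} (hu : ‖u‖ = 1) (hv : ‖v‖ = 1) :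
    v = u * Complex.exp (posArc u v * I) := by
  have hu0 : u ≠ 0 := by rintro rfl; simp at hu
  have h : Complex.exp (posArc u v * I) = Complex.exp (arg (v / u) * I) := by
    unfold posArc
    split_ifs
    · rfl
    · push_cast
      rw [add_mul, Complex.exp_add, Complex.exp_two_pi_mul_I, mul_one]
  have h2 := Complex.norm_mul_exp_arg_mul_I (v / u)
  rw [norm_div, hu, hv] at h2
  simp only [div_one, Complex.ofReal_one, one_mul] at h2
  rw [h, h2]
  field_simp

lemma arg_inj_circle {u v : ℂ} (hu : ‖u‖ = 1) (hv : ‖v‖ = 1) (h : arg u = arg v) : u = v :=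
  Complex.ext_norm_arg (hu.trans hv.symm) h

lemma exp_sub_one_half (x : ℝ) :
    Complex.exp (x * I) - 1
      = Complex.exp ((x / 2 : ℝ) * I) * (2 * I * (Real.sin (x / 2) : ℝ)) := by
  have e1 : Complex.exp (x * I) = Complex.exp ((x / 2 : ℝ) * I) * Complex.exp ((x / 2 : ℝ) * I) := by
    rw [← Complex.exp_add]; congr 1; push_cast; ring
  have e2 : Complex.exp ((x / 2 : ℝ) * I) * Complex.exp (-((x / 2 : ℝ) * I)) = 1 := by
    rw [← Complex.exp_add]; simp
  rw [Complex.ofReal_sin, Complex.sin, e1, neg_mul]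
  have hI : I * I = -1 := Complex.I_mul_I
  linear_combination (Complex.exp ((x / 2 : ℝ) * I) * (Complex.exp (-((x / 2 : ℝ) * I)) - Complex.exp ((x / 2 : ℝ) * I))) * (-hI) + e2

lemma vangle_eq {u v w : ℂ} (hu : ‖u‖ = 1) (hv : ‖v‖ = 1) (hw : ‖w‖ = 1) (h : ACW u v w) :
    vangle u v w = Real.pi - (posArc u v + posArc v w) / 2 := by
  obtain ⟨huv, hvw, huw, hlt⟩ := h
  have hpi := Real.pi_pos
  have hv0 : v ≠ 0 := by rintro rfl; simp at hv
  obtain ⟨a1, -⟩ := posArc_bounds u v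
  obtain ⟨b1, -⟩ := posArc_bounds v w
  have hsum : posArc u v + posArc v w < 2 * Real.pi := by
    have n1 : arg u ≠ arg v := fun h => huv (arg_inj_circle hu hv h)
    have n2 : arg v ≠ arg w := fun h => hvw (arg_inj_circle hv hw h)
    have n3 : arg u ≠ arg w := fun h => huw (arg_inj_circle hu hw h)
    have h1 := Complex.arg_le_pi u
    have h2 := Complex.neg_pi_lt_arg u
    have h3 := Complex.arg_le_pi v
    have h4 := Complex.neg_pi_lt_arg v
    have h5 := Complex.arg_le_pi w
    have h6 := Complex.neg_pi_lt_arg w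
    rw [posArc_arg hu hv, posArc_arg hu hw] at hlt
    rw [posArc_arg hu hv, posArc_arg hv hw]
    rcases lt_or_gt_of_ne n1 with n1 | n1 <;> rcases lt_or_gt_of_ne n2 with n2 | n2 <;>
      rcases lt_or_gt_of_ne n3 with n3 | n3 <;> split_ifs at hlt ⊢ <;> linarith
  have ew := exp_posArc hv hw
  have eu := exp_posArc hu hv
  set α := posArc u v
  set β := posArc v w
  have eu' : u = v * Complex.exp (((-α : ℝ)) * I) := by
    rw [eu, mul_assoc, ← Complex.exp_add]; simp
  have sa : 0 < Real.sin (α / 2) := Real.sin_pos_of_pos_of_lt_pi (by linarith) (by linarith)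
  have sb : 0 < Real.sin (β / 2) := Real.sin_pos_of_pos_of_lt_pi (by linarith) (by linarith)
  have main : (u - v) / (w - v) = ((Real.sin (α / 2) / Real.sin (β / 2) : ℝ) : ℂ) *
      (Complex.cos ((Real.pi - (α + β) / 2 : ℝ)) + Complex.sin ((Real.pi - (α + β) / 2 : ℝ)) * I) := by
    have e1 : u - v = v * (Complex.exp (((-α : ℝ)) * I) - 1) := by rw [mul_sub, ← eu', mul_one]
    have e2 : w - v = v * (Complex.exp (β * I) - 1) := by rw [mul_sub, ← ew, mul_one]
    have sb' : ((Real.sin (β / 2) : ℝ) : ℂ) ≠ 0 := by exact_mod_cast sb.ne'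
    rw [e1, e2, mul_div_mul_left _ _ hv0, exp_sub_one_half, exp_sub_one_half,
      ← Complex.exp_mul_I]
    have e3 : Complex.exp ((Real.pi - (α + β) / 2 : ℝ) * I)
        = - (Complex.exp ((-α / 2 : ℝ) * I) / Complex.exp ((β / 2 : ℝ) * I)) := by
      rw [← Complex.exp_sub]
      have : (((Real.pi - (α + β) / 2 : ℝ) : ℂ) * I)
        = Real.pi * I + (((-α / 2 : ℝ) : ℂ) * I - ((β / 2 : ℝ) : ℂ) * I) := by push_cast; ring
      rw [this, Complex.exp_add, Complex.exp_pi_mul_I]; ring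
    have e4 : Real.sin (-α / 2) = - Real.sin (α / 2) := by rw [neg_div, Real.sin_neg]
    rw [e3, e4]
    have := Complex.exp_ne_zero ((β / 2 : ℝ) * I)
    have := Complex.I_ne_zero
    field_simp
    rw [Complex.ofReal_div, Complex.ofReal_neg]
    field_simp
  unfold vangle
  rw [main, Complex.arg_mul_cos_add_sin_mul_I (div_pos sa sb) ⟨by linarith, by linarith⟩,
    abs_of_nonneg (by linarith)]

/-- The rank of a point: number of vertices with smaller argument. -/
def rk (P : CyclicPolygon) (v : ℂ) : ℕ := (P.V.filter (fun x => arg x < arg v)).card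

lemma edgeLength_rk (P : CyclicPolygon) {u v : ℂ} (hu : u ∈ P.V) (hv : v ∈ P.V) (huv : u ≠ v) :
    edgeLength P u v + rk P u = rk P v + P.V.card * (if arg v ≤ arg u then 1 else 0) := by
  have hset : ((P.V : Set ℂ) ∩ arcOO u v) = ((P.V.filter (fun x => x ∈ arcOO u v) : Finset ℂ) : Set ℂ) := by
    ext x; simp
  have h1 : (1 : ℕ) = (P.V.filter (fun x => x = u)).card := by
    rw [Finset.filter_eq', if_pos hu, Finset.card_singleton]
  unfold edgeLength rk
  rw [hset, Set.ncard_coe_finset]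
  nth_rewrite 1 [h1]
  rw [← smul_eq_mul, ← Finset.sum_const]
  simp only [Finset.card_filter]
  rw [← Finset.sum_add_distrib, ← Finset.sum_add_distrib, ← Finset.sum_add_distrib]
  apply Finset.sum_congr rfl
  intro x hx
  have nu := P.onCircle u hu
  have nv := P.onCircle v hv
  have nx := P.onCircle x hx
  have n1 : arg u ≠ arg v := fun h => huv (arg_inj_circle nu nv h)
  have h1 := Complex.arg_le_pi u
  have h2 := Complex.neg_pi_lt_arg u
  have h3 := Complex.arg_le_pi v
  have h4 := Complex.neg_pi_lt_arg v
  have h5 := Complex.arg_le_pi x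
  have h6 := Complex.neg_pi_lt_arg x
  by_cases hxu : x = u
  · subst hxu
    have : x ∉ arcOO x v := fun h => h.1 rfl
    rw [if_neg this]
    rcases lt_or_gt_of_ne n1 with n1 | n1
    · simp [n1, not_le.2 n1]
    · simp [n1.le, not_lt.2 n1.le]
  by_cases hxv : x = v
  · subst hxv
    have : x ∉ arcOO u x := fun h => h.2.1 rfl
    rw [if_neg this]
    rcases lt_or_gt_of_ne n1 with n1 | n1
    · simp [hxu, not_le.2 n1, not_lt.2 n1.le]
    · simp [hxu, n1.le, n1]
  have n2 : arg x ≠ arg u := fun h => hxu (arg_inj_circle nx nu h)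
  have n3 : arg x ≠ arg v := fun h => hxv (arg_inj_circle nx nv h)
  have hm : x ∈ arcOO u v ↔ posArc u x < posArc u v :=
    ⟨fun h => h.2.2, fun h => ⟨hxu, hxv, h⟩⟩
  simp only [hm, posArc_arg nu nx, posArc_arg nu nv, hxu, if_false]
  rcases lt_or_gt_of_ne n1 with n1 | n1 <;> rcases lt_or_gt_of_ne n2 with n2 | n2 <;>
    rcases lt_or_gt_of_ne n3 with n3 | n3 <;>
    simp only [n1, n2, n3, n1.le, n2.le, n3.le, not_le.2 n1, not_le.2 n2, not_le.2 n3,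
      not_lt.2 n1.le, not_lt.2 n2.le, not_lt.2 n3.le, if_true, if_false] <;>
    split_ifs <;> first | rfl | (exfalso; linarith)

/-- The interior angles of a `k`-star inscribed in a circle sum to `π`. -/
theorem star_angle_sum (k : ℕ) (hk : 0 < k) (S : CyclicPolygon) (h : IsKStar S k) :
    ∑ v ∈ S.V, interiorAngle S v = Real.pi := by
  obtain ⟨hcard, hlen⟩ := h
  have hang : ∀ v ∈ S.V, interiorAngle S v
      = Real.pi - (posArc (S.prev v) v + posArc v (S.next v)) / 2 := by
    intro v hv
    exact vangle_eq (S.onCircle _ (S.endmem _ (prev_mem S hv)).1) (S.onCircle _ hv)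
      (S.onCircle _ (S.endmem _ (next_mem S hv)).2) (S.acw _ _ _ (prev_mem S hv) (next_mem S hv))
  set c : ℂ → ℝ := fun v => if arg (S.next v) ≤ arg v then 1 else 0 with hc
  have harc : ∀ v ∈ S.V, posArc v (S.next v) = arg (S.next v) - arg v + 2 * Real.pi * c v := by
    intro v hv
    rw [posArc_arg (S.onCircle _ hv) (S.onCircle _ (S.endmem _ (next_mem S hv)).2)]
    simp only [hc]
    split_ifs <;> ring
  have hrk : ∀ v ∈ S.V, (k : ℝ) + rk S v = rk S (S.next v) + (2 * k + 1) * c v := by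
    intro v hv
    have hn := next_mem S hv
    have h1 := hlen _ hn
    have hne : v ≠ S.next v :=
      (S.acw _ _ _ (prev_mem S hv) hn).2.1
    have h2 := edgeLength_rk S hv (S.endmem _ hn).2 hne
    simp only at h1
    rw [h1, hcard] at h2
    have h3 := congrArg (Nat.cast : ℕ → ℝ) h2
    push_cast at h3
    exact h3
  have t1 := sum_next S (fun _ w => (arg w))
  have t2 := sum_next S (fun _ w => (rk S w : ℝ))
  have t3 := sum_next S posArc
  have s1 := Finset.sum_congr rfl harc
  have s2 := Finset.sum_congr rfl hrk
  have s3 := Finset.sum_congr rfl hang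
  simp only [Finset.sum_add_distrib, Finset.sum_sub_distrib, ← Finset.mul_sum,
    ← Finset.sum_div, Finset.sum_const, hcard, nsmul_eq_mul] at s1 s2 s3 t1 t2
  push_cast at s1 s2 s3
  have hcs : ∑ v ∈ S.V, c v = k := by
    have : (2 * (k : ℝ) + 1) * (∑ v ∈ S.V, c v) = (2 * k + 1) * k := by linarith
    exact mul_left_cancel₀ (by positivity) this
  rw [hcs] at s1
  rw [s3, t3, s1, ← t1]
  ring

end
end

section
/- Let m and n be positive integers, let s = m + n + 1, and let B be a subset of {1, 2, …, 2s} with |B| = 2m + 1. For i ∈ {1, …, 2s} define w(i) = |{j ∈ B : (j − i) mod 2s ∈ {1, …, s−1}}| − |{j ∈ B : (j − i) mod 2s ∈ {s+1, …, 2s−1}}|. Then the number of indices i ∈ B such that the unique element of {1, …, 2s} congruent to i + s modulo 2s does not belong to B and w(i) = 0 is odd. -/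
open Complex
open scoped Classical

noncomputable section

lemma core_parity (p : ℕ) (d : ℕ → ℤ) (hd : ∀ k, d k = 0 ∨ d k = 1 ∨ d k = -1)
    (hanti : ∀ k, d (k + (p + 1)) = - d k)
    (hodd : Odd (∑ k ∈ Finset.range (p + 1), d k)) :
    Odd (((Finset.range (p + 1)).filter fun t =>
      d t ≠ 0 ∧ ∑ k ∈ Finset.range p, d (t + (k + 1)) = 0).card) := by
  obtain ⟨H, hH⟩ : ∃ H : ℕ → ℤ, ∀ t, H t = ∑ k ∈ Finset.range (p + 1), d (t + k) :=
    ⟨_, fun _ => rfl⟩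
  have hF : ∀ t, ∑ k ∈ Finset.range p, d (t + (k + 1)) = H t - d t := by
    intro t
    rw [hH, Finset.sum_range_succ']
    simp
  have hstep : ∀ t, H (t + 1) = H t - 2 * d t := by
    intro t
    have h1 := hF t
    have h2 := hH (t + 1)
    rw [Finset.sum_range_succ] at h2
    have h3 : ∀ k, t + 1 + k = t + (k + 1) := fun k => by ring
    simp only [h3] at h2
    rw [h1, hanti t] at h2
    linarith
  have hHodd : ∀ t, H t % 2 = 1 := by
    intro t
    induction t with
    | zero =>
      rw [hH]
      simpa [Int.odd_iff] using hodd
    | succ t ih =>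
      rw [hstep]; omega
  have hHs : H (p + 1) = - H 0 := by
    rw [hH, hH, ← Finset.sum_neg_distrib]
    refine Finset.sum_congr rfl fun k _ => ?_
    rw [← hanti, zero_add, add_comm]
  have key : ∀ n, Odd (((Finset.range n).filter fun t =>
      d t ≠ 0 ∧ ∑ k ∈ Finset.range p, d (t + (k + 1)) = 0).card) ↔ (0 < H n ↔ ¬ 0 < H 0) := by
    intro n
    induction n with
    | zero => simp only [Finset.range_zero, Finset.filter_empty, Finset.card_empty]; simp; omega
    | succ n ih =>
      rw [Finset.range_add_one, Finset.filter_insert]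
      have h1 := hHodd n
      have h2 := hstep n
      rw [hF]
      split_ifs with h
      · rw [Finset.card_insert_of_notMem (by simp), Nat.odd_add_one, ih]
        have h3 : 0 < H (n + 1) ↔ ¬ 0 < H n := by
          rcases hd n with h0 | h0 | h0 <;> omega
        tauto
      · rw [ih]
        have h3 : 0 < H (n + 1) ↔ 0 < H n := by
          rcases hd n with h0 | h0 | h0 <;> omega
        tauto
  rw [key, hHs]
  have := hHodd 0
  omega

lemma mod_cases (N x : ℕ) (hx : x < 2 * N) :
    (x < N ∧ x % N = x) ∨ (N ≤ x ∧ x % N = x - N) := by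
  rcases lt_or_ge x N with h | h
  · exact Or.inl ⟨h, Nat.mod_eq_of_lt h⟩
  · exact Or.inr ⟨h, by rw [Nat.mod_eq_sub_mod h, Nat.mod_eq_of_lt (by omega)]⟩

lemma int_mod_cases (N x : ℤ) (h1 : -N < x) (h2 : x < N) :
    (0 ≤ x ∧ x % N = x) ∨ (x < 0 ∧ x % N = x + N) := by
  rcases lt_or_ge x 0 with h | h
  · exact Or.inr ⟨h, by rw [← Int.add_emod_right, Int.emod_eq_of_lt (by omega) (by omega)]⟩
  · exact Or.inl ⟨h, Int.emod_eq_of_lt h h2⟩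

lemma mem_lifted (B : Finset ℕ) (z : ℤ) :
    z ∈ (do let a ← B; pure (a : ℤ) : Finset ℤ) ↔ ∃ a ∈ B, (a : ℤ) = z := by
  simp [Finset.bind_def, Finset.pure_def, eq_comm]

lemma count_arc (N : ℕ) (B : Finset ℕ) (hB : B ⊆ Finset.Icc 1 N) (t : ℕ) (ht : t < N)
    (a p : ℕ) (hap : a + p < N) :
    ((B.filter fun j => (a : ℤ) + 1 ≤ ((j : ℤ) - ((t + 1 : ℕ) : ℤ)) % (N : ℤ) ∧
      ((j : ℤ) - ((t + 1 : ℕ) : ℤ)) % (N : ℤ) ≤ (a : ℤ) + p).card : ℤ) =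
    ∑ k ∈ Finset.range p, (if (t + (a + (k + 1))) % N + 1 ∈ B then (1 : ℤ) else 0) := by
  rw [← Finset.sum_filter, Finset.sum_const, nsmul_eq_mul, mul_one]
  congr 1
  symm
  refine Finset.card_bij (fun k _ => (((t + (a + (k + 1))) % N + 1 : ℕ) : ℤ)) ?_ ?_ ?_
  · intro k hk
    simp only [Finset.mem_filter, Finset.mem_range] at hk
    rw [Finset.mem_filter, mem_lifted]
    refine ⟨⟨_, hk.2, rfl⟩, ?_⟩
    have h1 := mod_cases N (t + (a + (k + 1))) (by omega)
    have h2 := int_mod_cases N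
      ((((t + (a + (k + 1))) % N + 1 : ℕ) : ℤ) - ((t + 1 : ℕ) : ℤ)) (by omega) (by omega)
    generalize (t + (a + (k + 1))) % N = y at *
    omega
  · intro k hk l hl h
    simp only [Finset.mem_filter, Finset.mem_range] at hk hl
    have h := Int.ofNat_inj.1 h
    have h1 := mod_cases N (t + (a + (k + 1))) (by omega)
    have h2 := mod_cases N (t + (a + (l + 1))) (by omega)
    generalize (t + (a + (k + 1))) % N = y at *
    generalize (t + (a + (l + 1))) % N = y' at *
    omega
  · intro j hj
    rw [Finset.mem_filter, mem_lifted] at hj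
    obtain ⟨⟨j, hjB, rfl⟩, hj1, hj2⟩ := hj
    have hjN := Finset.mem_Icc.1 (hB hjB)
    have h2 := int_mod_cases N ((j : ℤ) - ((t + 1 : ℕ) : ℤ)) (by omega) (by omega)
    obtain ⟨k, hk⟩ : ∃ k : ℕ, ((j : ℤ) - ((t + 1 : ℕ) : ℤ)) % (N : ℤ) = a + 1 + k :=
      ⟨(((j : ℤ) - ((t + 1 : ℕ) : ℤ)) % (N : ℤ) - a - 1).toNat, by omega⟩
    rw [hk] at hj1 hj2 h2
    have h1 := mod_cases N (t + (a + (k + 1))) (by omega)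
    have h3 : (t + (a + (k + 1))) % N + 1 = j := by omega
    refine ⟨k, ?_, by rw [h3]⟩
    simp only [Finset.mem_filter, Finset.mem_range]
    rw [h3]
    exact ⟨by omega, hjB⟩

/-- (The combinatorial weight lemma.) For `s = m + n + 1` and a subset `B` of
`{1, …, 2s}` of size `2m + 1`, with the weight `w` as below, the number of `i ∈ B` whose
antipode (the unique element of `{1, …, 2s}` congruent to `i + s` mod `2s`) is not in `B` and
with `w i = 0` is odd. -/
theorem odd_zero_weights (m n : ℕ) (hm : 0 < m) (hn : 0 < n) (s : ℕ) (hs : s = m + n + 1)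
    (B : Finset ℕ) (hBsub : B ⊆ Finset.Icc 1 (2 * s)) (hBcard : B.card = 2 * m + 1)
    (w : ℕ → ℤ)
    (hw : ∀ i : ℕ, w i =
      ((B.filter fun j => 1 ≤ ((j : ℤ) - (i : ℤ)) % (2 * (s : ℤ)) ∧
          ((j : ℤ) - (i : ℤ)) % (2 * (s : ℤ)) ≤ (s : ℤ) - 1).card : ℤ) -
      ((B.filter fun j => (s : ℤ) + 1 ≤ ((j : ℤ) - (i : ℤ)) % (2 * (s : ℤ)) ∧
          ((j : ℤ) - (i : ℤ)) % (2 * (s : ℤ)) ≤ 2 * (s : ℤ) - 1).card : ℤ)) :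
    Odd ((B.filter fun i => ((i + s - 1) % (2 * s) + 1) ∉ B ∧ w i = 0).card) := by
  obtain ⟨p, rfl⟩ : ∃ p, s = p + 1 := ⟨m + n, hs⟩
  obtain ⟨c, hc⟩ : ∃ c : ℕ → ℤ, ∀ k, c k = if k % (2 * (p + 1)) + 1 ∈ B then (1 : ℤ) else 0 :=
    ⟨_, fun _ => rfl⟩
  have hcper : ∀ k, c (k + (p + 1) + (p + 1)) = c k := by
    intro k
    rw [hc, hc, show k + (p + 1) + (p + 1) = k + 2 * (p + 1) by ring, Nat.add_mod_right]
  have hc01 : ∀ k, c k = 0 ∨ c k = 1 := by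
    intro k; rw [hc]; split_ifs <;> simp
  obtain ⟨d, hd⟩ : ∃ d : ℕ → ℤ, ∀ k, d k = c k - c (k + (p + 1)) := ⟨_, fun _ => rfl⟩
  have hanti : ∀ k, d (k + (p + 1)) = - d k := by
    intro k; rw [hd, hd, hcper]; ring
  have hwd : ∀ t, t < 2 * (p + 1) → w (t + 1) = ∑ k ∈ Finset.range p, d (t + (k + 1)) := by
    intro t ht
    have e1 := count_arc (2 * (p + 1)) B hBsub t ht 0 p (by omega)
    have e2 := count_arc (2 * (p + 1)) B hBsub t ht (p + 1) p (by omega)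
    simp only [← hc] at e1 e2
    have e3 : ∑ k ∈ Finset.range p, d (t + (k + 1)) =
        ∑ k ∈ Finset.range p, c (t + (0 + (k + 1))) -
          ∑ k ∈ Finset.range p, c (t + (p + 1 + (k + 1))) := by
      rw [← Finset.sum_sub_distrib]
      refine Finset.sum_congr rfl fun k _ => ?_
      rw [hd, zero_add, show t + (k + 1) + (p + 1) = t + (p + 1 + (k + 1)) by ring]
    rw [e3, ← e1, ← e2, hw]
    push_cast
    congr 3
    · refine Finset.filter_congr fun j _ => ?_
      constructor <;> rintro ⟨h1, h2⟩ <;> constructor <;> linarith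
    · refine Finset.filter_congr fun j _ => ?_
      constructor <;> rintro ⟨h1, h2⟩ <;> constructor <;> linarith
  -- transfer of counts from `B` to indices
  have hcount : ∀ (Q : ℕ → Prop) [DecidablePred Q], (((B.filter Q).card : ℕ) : ℤ) =
      ∑ t ∈ Finset.range (p + 1), ((if c t = 1 ∧ Q (t + 1) then (1 : ℤ) else 0) +
        (if c (t + (p + 1)) = 1 ∧ Q (t + (p + 1) + 1) then (1 : ℤ) else 0)) := by
    intro Q _
    have e1 : (B.filter Q).card = ((Finset.range ((p + 1) + (p + 1))).filter
        fun t => c t = 1 ∧ Q (t + 1)).card := by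
      symm
      refine Finset.card_bij (fun t _ => t + 1) ?_ ?_ ?_
      · intro t ht
        simp only [Finset.mem_filter, Finset.mem_range] at ht ⊢
        obtain ⟨h1, h2, h3⟩ := ht
        rw [hc, Nat.mod_eq_of_lt (by omega)] at h2
        refine ⟨?_, h3⟩
        by_contra h
        simp [h] at h2
      · intro a _ b _ h
        omega
      · intro j hj
        simp only [Finset.mem_filter] at hj
        have hjN := Finset.mem_Icc.1 (hBsub hj.1)
        obtain ⟨t, rfl⟩ : ∃ t, j = t + 1 := ⟨j - 1, by omega⟩
        refine ⟨t, ?_, rfl⟩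
        simp only [Finset.mem_filter, Finset.mem_range]
        refine ⟨by omega, ?_, hj.2⟩
        rw [hc, Nat.mod_eq_of_lt (by omega), if_pos hj.1]
    rw [e1, Finset.card_filter, Nat.cast_sum, Finset.sum_range_add, ← Finset.sum_add_distrib]
    refine Finset.sum_congr rfl fun t _ => ?_
    rw [add_comm (p + 1) t]
    push_cast
    rfl
  have hodd : Odd (∑ k ∈ Finset.range (p + 1), d k) := by
    have e := hcount (fun _ => True)
    rw [Finset.filter_true_of_mem (fun _ _ => trivial), hBcard] at e
    have e2 : ∑ k ∈ Finset.range (p + 1), d k = ((2 * m + 1 : ℕ) : ℤ) -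
        2 * ∑ k ∈ Finset.range (p + 1), c (k + (p + 1)) := by
      rw [e, Finset.mul_sum, ← Finset.sum_sub_distrib]
      refine Finset.sum_congr rfl fun k _ => ?_
      rw [hd]
      rcases hc01 k with h | h <;> rcases hc01 (k + (p + 1)) with h' | h' <;> simp [h, h']
    rw [e2, Int.odd_iff]
    push_cast
    omega
  have hcore := core_parity p d (by
    intro k
    rw [hd]
    rcases hc01 k with h | h <;> rcases hc01 (k + (p + 1)) with h' | h' <;> simp [h, h'])
    hanti hodd
  have hfin : (B.filter fun i => ((i + (p + 1) - 1) % (2 * (p + 1)) + 1) ∉ B ∧ w i = 0).card =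
      ((Finset.range (p + 1)).filter fun t =>
      d t ≠ 0 ∧ ∑ k ∈ Finset.range p, d (t + (k + 1)) = 0).card := by
    zify
    rw [hcount, Finset.card_filter, Nat.cast_sum]
    refine Finset.sum_congr rfl fun t ht => ?_
    have ht := Finset.mem_range.1 ht
    have hmem : ∀ t, ((t + 1 + (p + 1) - 1) % (2 * (p + 1)) + 1) ∉ B ↔ c (t + (p + 1)) = 0 := by
      intro t
      rw [hc, show t + 1 + (p + 1) - 1 = t + (p + 1) by omega]
      split_ifs with h <;> simp [h]
    have hw2 : w (t + (p + 1) + 1) = - ∑ k ∈ Finset.range p, d (t + (k + 1)) := by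
      rw [hwd _ (by omega), ← Finset.sum_neg_distrib]
      refine Finset.sum_congr rfl fun k _ => ?_
      rw [← hanti, show t + (p + 1) + (k + 1) = t + (k + 1) + (p + 1) by ring]
    simp only [hmem, hcper, hw2, hwd t (by omega), neg_eq_zero, hd t]
    rcases hc01 t with h | h <;> rcases hc01 (t + (p + 1)) with h' | h' <;> simp [h, h']
  rw [hfin]
  exact hcore

end
end
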